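/- Let a, b > 0 with a/b ∈ ℚ and let α ∈ ℝ. Then there exists K > 0 such that for all k > K with k > |α|, sin(a·k) ≠ 0 and sin(b·k) ≠ 0, the gap condition GC2 fails, i.e. 1/|sin(a·k)| − 2/|sin(b·k)| ≤ |cot(a·k) + 2·cot(b·k) + α/k|. (Hence GC2 generates at most finitely many gaps in the spectrum of the honeycomb-lattice Hamiltonian with edge lengths a, b, b.) -/

import Mathlib

open Real

/-- The representative of `x` modulo `π` in `[-π/2, π/2]` is bounded by `π / 2 * |sin x|`, and has the
same cotangent as `x`. -/
lemma exists_int_abs_sub_mul_pi_le (x : ℝ) :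
    ∃ n : ℤ, |x - n * π| ≤ π / 2 ∧ |x - n * π| ≤ π / 2 * |sin x| ∧
      cot (x - n * π) = cot x := by
  have hπ := pi_pos
  have hle : |x - round (x / π) * π| ≤ π / 2 := by
    have h := abs_sub_round (x / π)
    have heq : x - round (x / π) * π = (x / π - round (x / π)) * π := by field_simp
    rw [heq, abs_mul, abs_of_pos hπ]
    nlinarith
  refine ⟨round (x / π), hle, ?_, ?_⟩
  · have h := mul_abs_le_abs_sin hle
    have hsin : |sin (x - round (x / π) * π)| = |sin x| := by
      rw [sin_sub_int_mul_pi, abs_mul, abs_zpow, abs_neg, abs_one, one_zpow, one_mul]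
    rw [hsin] at h
    calc |x - round (x / π) * π| = π / 2 * (2 / π * |x - round (x / π) * π|) := by field_simp
      _ ≤ π / 2 * |sin x| := by gcongr
  · rw [cot_eq_cos_div_sin, cot_eq_cos_div_sin, sin_sub_int_mul_pi, cos_sub_int_mul_pi,
      mul_div_mul_left _ _ (zpow_ne_zero _ (by norm_num))]

/-- If `x / y = p / q` and both `sin x` and `sin y` are small, then `cot x` and `cot y` have the same
sign. -/
lemma cot_mul_cot_nonneg_of_abs_sin_small {x y p q e : ℝ} (hp : 0 < p) (hq : 0 < q)
    (hpi : ∃ m : ℤ, p = m) (hqi : ∃ m : ℤ, q = m) (hxy : q * x = p * y)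
    (hx : |sin x| ≤ e) (hy : |sin y| ≤ 2 * e) (he : e * (p + q) < 1) :
    0 ≤ cot x * cot y := by
  have hπ := pi_pos
  obtain ⟨n, hn, hn', hcx⟩ := exists_int_abs_sub_mul_pi_le x
  obtain ⟨m, hm, hm', hcy⟩ := exists_int_abs_sub_mul_pi_le y
  rw [← hcx, ← hcy]
  set x' := x - n * π with hx'
  set y' := y - m * π with hy'
  have he0 : 0 ≤ e := (abs_nonneg _).trans hx
  have hdiff : q * x' - p * y' = (p * m - q * n) * π := by
    rw [hx', hy']; linear_combination hxy
  have hbound : |q * x' - p * y'| < π := by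
    have hx2 : |x'| ≤ π * e := by nlinarith
    have hy2 : |y'| ≤ π * e := by nlinarith
    calc |q * x' - p * y'| ≤ |q * x'| + |p * y'| := abs_sub _ _
      _ = q * |x'| + p * |y'| := by rw [abs_mul, abs_mul, abs_of_pos hp, abs_of_pos hq]
      _ ≤ q * (π * e) + p * (π * e) := by gcongr
      _ = π * (e * (p + q)) := by ring
      _ < π := by nlinarith
  have hzero : p * m - q * n = 0 := by
    obtain ⟨P, rfl⟩ := hpi
    obtain ⟨Q, rfl⟩ := hqi
    rw [hdiff, abs_mul, abs_of_pos hπ] at hbound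
    have h1 : |(P * m - Q * n : ℝ)| < 1 := by nlinarith
    have h2 : |P * m - Q * n| < 1 := by exact_mod_cast h1
    exact_mod_cast Int.abs_lt_one_iff.mp h2
  have hprop : q * x' = p * y' := by rw [hzero, zero_mul] at hdiff; linarith
  have hcosx := cos_nonneg_of_mem_Icc (abs_le.mp hn)
  have hcosy := cos_nonneg_of_mem_Icc (abs_le.mp hm)
  rw [abs_le] at hn hm
  rw [cot_eq_cos_div_sin, cot_eq_cos_div_sin, div_mul_div_comm]
  refine div_nonneg (mul_nonneg hcosx hcosy) ?_
  rcases le_total 0 x' with h | h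
  · have h' : 0 ≤ y' := by
      by_contra! hlt
      nlinarith [mul_nonneg hq.le h, mul_pos hp (neg_pos.mpr hlt)]
    exact mul_nonneg (sin_nonneg_of_nonneg_of_le_pi h (by linarith))
      (sin_nonneg_of_nonneg_of_le_pi h' (by linarith))
  · have h' : y' ≤ 0 := by
      by_contra! hlt
      nlinarith [mul_nonneg hq.le (neg_nonneg.mpr h), mul_pos hp hlt]
    exact mul_nonneg_of_nonpos_of_nonpos
      (sin_nonpos_of_nonpos_of_neg_pi_le h (by linarith))
      (sin_nonpos_of_nonpos_of_neg_pi_le h' (by linarith))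

lemma one_div_abs_sin_sq {x : ℝ} (hx : sin x ≠ 0) : (1 / |sin x|) ^ 2 = 1 + |cot x| ^ 2 := by
  rw [div_pow, sq_abs, sq_abs, cot_eq_cos_div_sin]
  field_simp
  linarith [sin_sq_add_cos_sq x]

/-- Here `u, v` play the role of absolute cosecants, and `c, d` of the corresponding cotangents. -/
lemma gap_imp_small_and_opposite {u v c d t e : ℝ} (hu : 0 < u) (hv : 0 < v)
    (huc : u ^ 2 = 1 + |c| ^ 2) (hvd : v ^ 2 = 1 + |d| ^ 2) (ht : |t| = e) (he : e < 1)
    (h : |c + 2 * d + t| < u - 2 * v) :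
    1 < 2 * v * e ∧ 1 < u * e ∧ c * d < 0 := by
  have hc := abs_nonneg c
  have hd := abs_nonneg d
  have he0 : 0 ≤ e := ht ▸ abs_nonneg t
  have huv : 2 * v < u := by linarith [abs_nonneg (c + 2 * d + t)]
  have hv1 : 1 ≤ v := by nlinarith
  have hcd : |d| < |c| := by nlinarith
  have hdv : |d| < v := by nlinarith
  have huc' : (u - |c|) * (u + |c|) = 1 := by linarith
  have hvd' : (v - |d|) * (v + |d|) = 1 := by linarith
  have htri : |c + 2 * d| ≤ |c + 2 * d + t| + e := by
    have := abs_sub (c + 2 * d + t) t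
    rwa [add_sub_cancel_right, ht] at this
  have htri' : |c| ≤ |c + 2 * d| + 2 * |d| := by
    have := abs_sub (c + 2 * d) (2 * d)
    rwa [add_sub_cancel_right, abs_mul 2 d, abs_two] at this
  have hlt : u - |c| < v - |d| := by
    by_contra! hge
    nlinarith [mul_le_mul_of_nonneg_right hge (by linarith : 0 ≤ u + |c|),
      mul_pos (sub_pos.mpr hdv) (by linarith : 0 < u + |c| - (v + |d|))]
  have hve : v - |d| < e := by linarith
  have hsmall : 1 < 2 * v * e := by
    nlinarith [mul_pos (sub_pos.mpr hve) (by linarith : 0 < v + |d|)]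
  refine ⟨hsmall, by nlinarith, ?_⟩
  by_contra! hsign
  have hsum : |c + 2 * d| = |c| + 2 * |d| := by
    have : |c + 2 * d| = |c| + |2 * d| := by
      rw [abs_add_eq_add_abs_iff]
      rcases mul_nonneg_iff.mp hsign with h | h
      · exact Or.inl ⟨h.1, by linarith [h.2]⟩
      · exact Or.inr ⟨h.1, by linarith [h.2]⟩
    rw [this, abs_mul, abs_two]
  linarith

/-- If `a/b ∈ ℚ`, the gap condition GC2 fails for all sufficiently large `k`:
GC2 generates at most finitely many gaps. -/
theorem GC2_finitely_many_gaps_rational (a b α : ℝ) (ha : 0 < a) (hb : 0 < b)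
    (hrat : ∃ r : ℚ, a / b = (r : ℝ)) :
    ∃ K : ℝ, 0 < K ∧ ∀ k : ℝ, k > K → k > |α| →
      Real.sin (a * k) ≠ 0 → Real.sin (b * k) ≠ 0 →
      1 / |Real.sin (a * k)| - 2 / |Real.sin (b * k)|
        ≤ |Real.cot (a * k) + 2 * Real.cot (b * k) + α / k| := by
  obtain ⟨r, hr⟩ := hrat
  have hrpos : 0 < r := by exact_mod_cast hr ▸ div_pos ha hb
  have hp : (0 : ℝ) < r.num := by exact_mod_cast Rat.num_pos.mpr hrpos
  have hq : (0 : ℝ) < r.den := by exact_mod_cast r.den_pos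
  have hab : r.den * a = r.num * b := by
    rw [Rat.cast_def] at hr
    field_simp at hr
    linarith
  have hα := abs_nonneg α
  refine ⟨|α| * (r.num + r.den) + 1, by positivity, fun k hk hkα hsx hsy => ?_⟩
  have hk0 : 0 < k := hα.trans_lt hkα
  have hx := abs_pos.mpr hsx
  have hy := abs_pos.mpr hsy
  by_contra! hgap
  obtain ⟨h1, h2, h3⟩ := gap_imp_small_and_opposite (e := |α| / k) (t := α / k)
    (one_div_pos.mpr hx) (one_div_pos.mpr hy) (one_div_abs_sin_sq hsx) (one_div_abs_sin_sq hsy)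
    (by rw [abs_div, abs_of_pos hk0]) ((div_lt_one hk0).mpr hkα) (by rwa [mul_one_div])
  refine h3.not_ge (cot_mul_cot_nonneg_of_abs_sin_small (e := |α| / k) hp hq ⟨r.num, rfl⟩
    ⟨r.den, by simp⟩ (by linear_combination k * hab) ?_ ?_ ?_)
  · rw [one_div_mul_eq_div, one_lt_div hx] at h2
    exact h2.le
  · rw [mul_one_div, div_mul_eq_mul_div, one_lt_div hy] at h1
    exact h1.le
  · rw [div_mul_eq_mul_div, div_lt_one hk0]
    linarith
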